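/- arXiv:2201.06003 — 4 statements merged into one kernel-verified Lean document; each statement's English description precedes it below -/
import Mathlib

section
/- Let H ∈ (0, 1/2), let p ≥ 1, and let 0 ≤ a < b ≤ c < d be real numbers. Define R(s,t) := (1/2)(s^{2H} + t^{2H} − |t−s|^{2H}). Then for every grid partition a = u_0 < u_1 < … < u_m = b and c = v_0 < v_1 < … < v_{m'} = d: (i) every rectangle increment ΔR_{ij} := R(u_{i+1},v_{j+1}) − R(u_{i+1},v_j) − R(u_i,v_{j+1}) + R(u_i,v_j) satisfies ΔR_{ij} ≤ 0, and (ii) ∑_{i=0}^{m−1} ∑_{j=0}^{m'−1} |ΔR_{ij}|^p ≤ |R(b,d) − R(b,c) − R(a,d) + R(a,c)|^p. -/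
theorem ConcaveOn.add_le_add_of_add_eq {s : Set ℝ} {f : ℝ → ℝ} (hf : ConcaveOn ℝ s f)
    {x y z w : ℝ} (hx : x ∈ s) (hw : w ∈ s) (hxy : x ≤ y) (hxz : x ≤ z) (h : x + w = y + z) :
    f x + f w ≤ f y + f z := by
  rcases eq_or_lt_of_le (show x ≤ w by linarith) with hxw | hxw
  · rw [show y = x by linarith, show z = w by linarith]
  have hpos : 0 < w - x := sub_pos.2 hxw
  have hα : 0 ≤ (y - x) / (w - x) := div_nonneg (by linarith) hpos.le
  have hβ : 0 ≤ (z - x) / (w - x) := div_nonneg (by linarith) hpos.le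
  have hαβ : (y - x) / (w - x) + (z - x) / (w - x) = 1 := by
    rw [← add_div, div_eq_one_iff_eq hpos.ne']
    linarith
  have hα_mul : (y - x) / (w - x) * (w - x) = y - x := div_mul_cancel₀ _ hpos.ne'
  have hβ_mul : (z - x) / (w - x) * (w - x) = z - x := div_mul_cancel₀ _ hpos.ne'
  have hz := hf.2 hx hw hα hβ hαβ
  have hy := hf.2 hx hw hβ hα (by rw [add_comm, hαβ])
  generalize (y - x) / (w - x) = α at *
  generalize (z - x) / (w - x) = β at *
  obtain rfl : β = 1 - α := by linarith
  simp only [smul_eq_mul] at hy hz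
  rw [show α * x + (1 - α) * w = z by linarith] at hz
  rw [show (1 - α) * x + α * w = y by linarith] at hy
  linarith

theorem Real.sum_rpow_le_rpow_sum {ι : Type*} (s : Finset ι) {f : ι → ℝ} {p : ℝ} (hp : 1 ≤ p)
    (hf : ∀ i ∈ s, 0 ≤ f i) : ∑ i ∈ s, f i ^ p ≤ (∑ i ∈ s, f i) ^ p := by
  induction s using Finset.cons_induction with
  | empty => simp [Real.zero_rpow (by linarith : p ≠ 0)]
  | cons i s hi ih =>
    simp only [Finset.forall_mem_cons] at hf
    rw [Finset.sum_cons, Finset.sum_cons]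
    exact (by gcongr; exact ih hf.2 : _ ≤ f i ^ p + (∑ j ∈ s, f j) ^ p).trans
      (Real.add_rpow_le_rpow_add hf.1 (Finset.sum_nonneg hf.2) hp)

theorem Finset.sum_range_rectangle_increment {α M : Type*} [AddCommGroup M] (g : α → α → M)
    (u v : ℕ → α) (m n : ℕ) :
    ∑ i ∈ Finset.range m, ∑ j ∈ Finset.range n,
        (g (u (i + 1)) (v (j + 1)) - g (u (i + 1)) (v j) - g (u i) (v (j + 1)) + g (u i) (v j))
      = g (u m) (v n) - g (u m) (v 0) - g (u 0) (v n) + g (u 0) (v 0) := by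
  have hinner : ∀ i, ∑ j ∈ Finset.range n,
      (g (u (i + 1)) (v (j + 1)) - g (u (i + 1)) (v j) - g (u i) (v (j + 1)) + g (u i) (v j))
      = (g (u (i + 1)) (v n) - g (u (i + 1)) (v 0)) - (g (u i) (v n) - g (u i) (v 0)) := by
    intro i
    rw [← Finset.sum_range_sub (fun j => g (u (i + 1)) (v j)),
      ← Finset.sum_range_sub (fun j => g (u i) (v j)), ← Finset.sum_sub_distrib]
    exact Finset.sum_congr rfl fun j _ => by abel
  simp only [hinner]
  rw [Finset.sum_range_sub (fun i => g (u i) (v n) - g (u i) (v 0))]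
  abel

theorem le_of_forall_lt_succ_of_le {α : Type*} [Preorder α] {u : ℕ → α} {m : ℕ}
    (hu : ∀ i < m, u i < u (i + 1)) {i j : ℕ} (hij : i ≤ j) (hj : j ≤ m) : u i ≤ u j := by
  induction j, hij using Nat.le_induction with
  | base => exact le_rfl
  | succ k _ ih => exact (ih (by omega)).trans (hu k (by omega)).le


/-- Let `H ∈ (0,1/2)`, `p ≥ 1`, `0 ≤ a < b ≤ c < d`, and let
`R(s,t) = (1/2)(s^{2H} + t^{2H} − |t−s|^{2H})` be the fBm covariance.  For every
grid partition `a = u_0 < … < u_m = b`, `c = v_0 < … < v_{m'} = d`: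
(i) every rectangle increment `ΔR_{ij}` of `R` is `≤ 0`, and
(ii) `∑_{i,j} |ΔR_{ij}|^p ≤ |R(b,d) − R(b,c) − R(a,d) + R(a,c)|^p`. -/
theorem fbm_cov_rectangle_increments_neg_and_pvar_bound
    (H p : ℝ) (hH0 : 0 < H) (hH : H < 1/2) (hp : 1 ≤ p)
    (a b c d : ℝ) (ha : 0 ≤ a) (hab : a < b) (hbc : b ≤ c) (hcd : c < d)
    (R : ℝ → ℝ → ℝ)
    (hR : ∀ s t : ℝ, R s t = (1/2) * (s ^ (2*H) + t ^ (2*H) - |t - s| ^ (2*H)))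
    (m m' : ℕ) (hm : 0 < m) (hm' : 0 < m')
    (u v : ℕ → ℝ)
    (hu : ∀ i < m, u i < u (i+1)) (hu0 : u 0 = a) (hum : u m = b)
    (hv : ∀ j < m', v j < v (j+1)) (hv0 : v 0 = c) (hvm : v m' = d) :
    (∀ i < m, ∀ j < m',
      R (u (i+1)) (v (j+1)) - R (u (i+1)) (v j) - R (u i) (v (j+1)) + R (u i) (v j) ≤ 0)
    ∧ ∑ i ∈ Finset.range m, ∑ j ∈ Finset.range m',
        |R (u (i+1)) (v (j+1)) - R (u (i+1)) (v j) - R (u i) (v (j+1)) + R (u i) (v j)| ^ p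
      ≤ |R b d - R b c - R a d + R a c| ^ p := by
  have hneg : ∀ i < m, ∀ j < m',
      R (u (i+1)) (v (j+1)) - R (u (i+1)) (v j) - R (u i) (v (j+1)) + R (u i) (v j) ≤ 0 := by
    intro i hi j hj
    have hub : u (i + 1) ≤ b := hum ▸ le_of_forall_lt_succ_of_le hu (Nat.succ_le_of_lt hi) le_rfl
    have hcv : c ≤ v j := hv0 ▸ le_of_forall_lt_succ_of_le hv (Nat.zero_le j) hj.le
    have hui := hu i hi
    have hvj := hv j hj
    have hconc := (Real.concaveOn_rpow (p := 2 * H) (by linarith)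
      (by linarith)).add_le_add_of_add_eq (x := v j - u (i + 1)) (y := v j - u i)
      (z := v (j + 1) - u (i + 1)) (w := v (j + 1) - u i)
      (Set.mem_Ici.2 (by linarith)) (Set.mem_Ici.2 (by linarith)) (by linarith) (by linarith)
      (by ring)
    simp only [hR]
    rw [abs_of_nonneg (show 0 ≤ v j - u (i + 1) by linarith),
      abs_of_nonneg (show 0 ≤ v j - u i by linarith),
      abs_of_nonneg (show 0 ≤ v (j + 1) - u (i + 1) by linarith),
      abs_of_nonneg (show 0 ≤ v (j + 1) - u i by linarith)]
    linarith
  refine ⟨hneg, ?_⟩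
  have htotal := Finset.sum_range_rectangle_increment R u v m m'
  rw [hu0, hum, hv0, hvm] at htotal
  rw [← htotal, ← Finset.sum_product', ← Finset.sum_product']
  have hmem : ∀ x ∈ Finset.range m ×ˢ Finset.range m', R (u (x.1+1)) (v (x.2+1)) -
      R (u (x.1+1)) (v x.2) - R (u x.1) (v (x.2+1)) + R (u x.1) (v x.2) ≤ 0 := fun x hx =>
    hneg x.1 (Finset.mem_range.1 (Finset.mem_product.1 hx).1) x.2
      (Finset.mem_range.1 (Finset.mem_product.1 hx).2)
  rw [abs_of_nonpos (Finset.sum_nonpos hmem), ← Finset.sum_neg_distrib,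
    ← Finset.sum_congr rfl fun x hx => abs_of_nonpos (hmem x hx)]
  exact Real.sum_rpow_le_rpow_sum _ hp fun _ _ => abs_nonneg _
end

section
/- Let H ∈ (0, 1/2]. Define R(s,t) := (1/2)(s^{2H} + t^{2H} − |t−s|^{2H}) for s,t ≥ 0. There exists a constant C, depending only on H, such that for all 0 ≤ s < t and every grid partition s = u_0 < u_1 < … < u_m = t and s = v_0 < v_1 < … < v_{m'} = t of the square [s,t]², one has ∑_{i=0}^{m−1} ∑_{j=0}^{m'−1} |R(u_{i+1},v_{j+1}) − R(u_{i+1},v_j) − R(u_i,v_{j+1}) + R(u_i,v_j)|^{1/(2H)} ≤ C (t − s). (Equivalently, the 2D (1/(2H))-variation of R on [s,t]² is at most C^{2H} |t−s|^{2H}.) -/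
open Finset in
/-- The `p`-th power sum of nonnegative reals with total at most `M` is at most `M ^ p`. -/
theorem sum_rpow_le_of_sum_le {n : ℕ} {a : ℕ → ℝ} {p M : ℝ} (hp : 1 ≤ p)
    (ha : ∀ i, 0 ≤ a i) (hM : ∑ i ∈ range n, a i ≤ M) :
    ∑ i ∈ range n, a i ^ p ≤ M ^ p := by
  have hM0 : 0 ≤ M := (sum_nonneg fun i _ => ha i).trans hM
  have split : ∀ x : ℝ, 0 ≤ x → x ^ p = x * x ^ (p - 1) := fun x hx => by
    have h := Real.rpow_one_add' (y := p - 1) hx (by linarith)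
    rwa [add_sub_cancel] at h
  calc ∑ i ∈ range n, a i ^ p ≤ ∑ i ∈ range n, a i * M ^ (p - 1) := by
        refine sum_le_sum fun i hi => ?_
        rw [split _ (ha i)]
        have hiM : a i ≤ M := (single_le_sum (fun j _ => ha j) hi).trans hM
        exact mul_le_mul_of_nonneg_left
          (Real.rpow_le_rpow (ha i) hiM (by linarith)) (ha i)
    _ = (∑ i ∈ range n, a i) * M ^ (p - 1) := by rw [sum_mul]
    _ ≤ M * M ^ (p - 1) := mul_le_mul_of_nonneg_right hM (Real.rpow_nonneg hM0 _)
    _ = M ^ p := (split M hM0).symm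

/-- Increments of the concave function `x ↦ x ^ α` over steps of fixed length decrease. -/
theorem rpow_increment_antitone {α d x y : ℝ} (hα0 : 0 ≤ α) (hα1 : α ≤ 1) (hd : 0 < d)
    (hx : 0 ≤ x) (hxy : x ≤ y) :
    (y + d) ^ α - y ^ α ≤ (x + d) ^ α - x ^ α := by
  have hc := (Real.concaveOn_rpow hα0 hα1).2
  have hL : 0 < y + d - x := by linarith
  have hx' : x ∈ Set.Ici (0 : ℝ) := hx
  have hy' : y + d ∈ Set.Ici (0 : ℝ) := by simp only [Set.mem_Ici]; linarith
  have hw0 : 0 ≤ d / (y + d - x) := by positivity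
  have hw1 : 0 ≤ (y - x) / (y + d - x) := div_nonneg (by linarith) hL.le
  have hw : d / (y + d - x) + (y - x) / (y + d - x) = 1 := by field_simp; ring
  have h1 := hc hx' hy' hw0 hw1 hw
  have h2 := hc hx' hy' hw1 hw0 (by rw [add_comm]; exact hw)
  simp only [smul_eq_mul] at h1 h2
  have e1 : d / (y + d - x) * x + (y - x) / (y + d - x) * (y + d) = y := by field_simp; ring
  have e2 : (y - x) / (y + d - x) * x + d / (y + d - x) * (y + d) = x + d := by
    field_simp; ring
  rw [e1] at h1
  rw [e2] at h2
  linear_combination h1 + h2 - (x ^ α + (y + d) ^ α) * hw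

/-- The function `v ↦ |v - a| ^ α - |v - b| ^ α` decreases, increases, then decreases, within
`[-(b - a) ^ α, (b - a) ^ α]`; hence its total variation is at most `4 (b - a) ^ α`. -/
theorem sum_abs_sub_rpow_increment_le {α a b : ℝ} (hα0 : 0 < α) (hα1 : α ≤ 1) (hab : a < b)
    (n : ℕ) (v : ℕ → ℝ) (hv : ∀ j < n, v j ≤ v (j + 1)) :
    ∑ j ∈ Finset.range n, |(|v (j + 1) - a| ^ α - |v (j + 1) - b| ^ α)
      - (|v j - a| ^ α - |v j - b| ^ α)| ≤ 4 * (b - a) ^ α := by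
  set f : ℝ → ℝ := fun x => |x - a| ^ α - |x - b| ^ α with hf
  have left : ∀ x y, x ≤ y → y ≤ a → f y ≤ f x := fun x y hxy hy => by
    have h := rpow_increment_antitone (x := a - y) (y := a - x) hα0.le hα1
      (sub_pos.2 hab) (by linarith) (by linarith)
    rw [show a - x + (b - a) = b - x by ring, show a - y + (b - a) = b - y by ring] at h
    simp only [hf]
    rw [abs_of_nonpos (by linarith : y - a ≤ 0), abs_of_nonpos (by linarith : y - b ≤ 0),
      abs_of_nonpos (by linarith : x - a ≤ 0), abs_of_nonpos (by linarith : x - b ≤ 0)]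
    simp only [neg_sub]
    linarith
  have mid : ∀ x y, a ≤ x → x ≤ y → y ≤ b → f x ≤ f y := fun x y hx hxy hy => by
    simp only [hf]
    rw [abs_of_nonneg (by linarith : 0 ≤ y - a), abs_of_nonpos (by linarith : y - b ≤ 0),
      abs_of_nonneg (by linarith : 0 ≤ x - a), abs_of_nonpos (by linarith : x - b ≤ 0)]
    have h1 := Real.rpow_le_rpow (by linarith : 0 ≤ x - a) (by linarith : x - a ≤ y - a) hα0.le
    have h2 := Real.rpow_le_rpow (by linarith : 0 ≤ -(y - b))
      (by linarith : -(y - b) ≤ -(x - b)) hα0.le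
    linarith
  have right : ∀ x y, b ≤ x → x ≤ y → f y ≤ f x := fun x y hx hxy => by
    have h := rpow_increment_antitone (x := x - b) (y := y - b) hα0.le hα1
      (sub_pos.2 hab) (by linarith) (by linarith)
    rw [show y - b + (b - a) = y - a by ring, show x - b + (b - a) = x - a by ring] at h
    simp only [hf]
    rwa [abs_of_nonneg (by linarith : 0 ≤ y - a), abs_of_nonneg (by linarith : 0 ≤ y - b),
      abs_of_nonneg (by linarith : 0 ≤ x - a), abs_of_nonneg (by linarith : 0 ≤ x - b)]
  have fa : f a = -(b - a) ^ α := by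
    simp only [hf]
    rw [abs_of_nonpos (by linarith : a - b ≤ 0), sub_self, abs_zero, Real.zero_rpow hα0.ne']
    simp
  have fb : f b = (b - a) ^ α := by
    simp only [hf]
    rw [abs_of_nonneg (by linarith : 0 ≤ b - a), sub_self, abs_zero, Real.zero_rpow hα0.ne',
      sub_zero]
  have f_left_nonpos : ∀ x ≤ a, f x ≤ 0 := fun x hx => by
    have := Real.rpow_le_rpow (abs_nonneg (x - a)) (z := α) (y := |x - b|) (by
      rw [abs_of_nonpos (by linarith : x - a ≤ 0), abs_of_nonpos (by linarith : x - b ≤ 0)]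
      linarith) hα0.le
    simp only [hf]
    linarith
  have f_right_nonneg : ∀ x, b ≤ x → 0 ≤ f x := fun x hx => by
    have := Real.rpow_le_rpow (abs_nonneg (x - b)) (z := α) (y := |x - a|) (by
      rw [abs_of_nonneg (by linarith : 0 ≤ x - a), abs_of_nonneg (by linarith : 0 ≤ x - b)]
      linarith) hα0.le
    simp only [hf]
    linarith
  let F : ℝ → ℝ := fun x => f (max a (min x b)) - f (min x a) - f (max x b)
  have step : ∀ x y, x ≤ y → |f y - f x| ≤ F y - F x := fun x y hxy => by
    have decomp : ∀ z, f z = f (min z a) + f (max a (min z b)) + f (max z b) - f a - f b := by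
      intro z
      rcases le_total z a with hza | hza
      · rw [min_eq_left hza, min_eq_left (hza.trans hab.le), max_eq_left hza,
          max_eq_right (hza.trans hab.le)]
        ring
      · rcases le_total z b with hzb | hzb
        · rw [min_eq_right hza, min_eq_left hzb, max_eq_right hza, max_eq_right hzb]
          ring
        · rw [min_eq_right hza, min_eq_right hzb, max_eq_right hab.le, max_eq_left hzb]
          ring
    have h1 := left (min x a) (min y a) (min_le_min_right a hxy) (min_le_right _ _)
    have h2 := mid (max a (min x b)) (max a (min y b)) (le_max_left _ _)
      (max_le_max_left a (min_le_min_right b hxy)) (max_le hab.le (min_le_right _ _))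
    have h3 := right (max x b) (max y b) (le_max_right _ _) (max_le_max_right b hxy)
    rw [decomp x, decomp y, abs_le]
    simp only [F]
    constructor <;> linarith
  have F_upper : ∀ z, F z ≤ 2 * (b - a) ^ α := fun z => by
    have h1 := left (min z a) a (min_le_right _ _) le_rfl
    have h2 := mid (max a (min z b)) b (le_max_left _ _) (max_le hab.le (min_le_right _ _)) le_rfl
    have h3 := f_right_nonneg (max z b) (le_max_right _ _)
    simp only [F]
    linarith
  have F_lower : ∀ z, -(2 * (b - a) ^ α) ≤ F z := fun z => by
    have h1 := f_left_nonpos (min z a) (min_le_right _ _)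
    have h2 := mid a (max a (min z b)) le_rfl (le_max_left _ _) (max_le hab.le (min_le_right _ _))
    have h3 := right b (max z b) le_rfl (le_max_right _ _)
    simp only [F]
    linarith
  calc ∑ j ∈ Finset.range n, |f (v (j + 1)) - f (v j)|
      ≤ ∑ j ∈ Finset.range n, (F (v (j + 1)) - F (v j)) :=
        Finset.sum_le_sum fun j hj => step _ _ (hv j (Finset.mem_range.1 hj))
    _ = F (v n) - F (v 0) := Finset.sum_range_sub (fun j => F (v j)) n
    _ ≤ 4 * (b - a) ^ α := by linarith [F_upper (v n), F_lower (v 0)]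


/-- Let `H ∈ (0, 1/2]` and `R(s,t) = (1/2)(s^{2H} + t^{2H} − |t−s|^{2H})`.
There is a constant `C` (depending only on `H`) such that for all `0 ≤ s < t` and every
grid partition `s = u_0 < … < u_m = t`, `s = v_0 < … < v_{m'} = t` of `[s,t]²`,
`∑_{i,j} |ΔR_{ij}|^{1/(2H)} ≤ C (t − s)`, where `ΔR_{ij}` is the rectangle increment of
`R` over `[u_i,u_{i+1}]×[v_j,v_{j+1}]`.  (Equivalently, the 2D `1/(2H)`-variation of `R`
on `[s,t]²` is at most `C^{2H}|t−s|^{2H}`.) -/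
theorem fbm_cov_two_dim_variation_bound
    (H : ℝ) (hH0 : 0 < H) (hH : H ≤ 1/2)
    (R : ℝ → ℝ → ℝ)
    (hR : ∀ s t : ℝ, R s t = (1/2) * (s ^ (2*H) + t ^ (2*H) - |t - s| ^ (2*H))) :
    ∃ C : ℝ, ∀ s t : ℝ, 0 ≤ s → s < t →
      ∀ (m m' : ℕ), 0 < m → 0 < m' →
      ∀ u v : ℕ → ℝ,
        (∀ i < m, u i < u (i+1)) → u 0 = s → u m = t →
        (∀ j < m', v j < v (j+1)) → v 0 = s → v m' = t →
        ∑ i ∈ Finset.range m, ∑ j ∈ Finset.range m',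
          |R (u (i+1)) (v (j+1)) - R (u (i+1)) (v j)
            - R (u i) (v (j+1)) + R (u i) (v j)| ^ (1/(2*H))
        ≤ C * (t - s) := by
  have hα0 : 0 < 2 * H := by linarith
  have hp : 1 ≤ 1 / (2 * H) := by rw [le_div_iff₀ hα0]; linarith
  refine ⟨2 ^ (1 / (2 * H)), fun s t _ _ m m' _ _ u v hu hu0 hum hv _ _ => ?_⟩
  have row : ∀ i < m, ∑ j ∈ Finset.range m',
      |R (u (i+1)) (v (j+1)) - R (u (i+1)) (v j)
        - R (u i) (v (j+1)) + R (u i) (v j)| ^ (1/(2*H))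
      ≤ 2 ^ (1 / (2 * H)) * (u (i + 1) - u i) := by
    intro i hi
    have hd : 0 ≤ u (i + 1) - u i := (sub_pos.2 (hu i hi)).le
    have htv := sum_abs_sub_rpow_increment_le hα0 (by linarith) (hu i hi) m' v
      fun j hj => (hv j hj).le
    have key : ∑ j ∈ Finset.range m', |R (u (i+1)) (v (j+1)) - R (u (i+1)) (v j)
        - R (u i) (v (j+1)) + R (u i) (v j)| ≤ 2 * (u (i + 1) - u i) ^ (2 * H) := by
      calc _ = ∑ j ∈ Finset.range m', (1 / 2) *
            |(|v (j + 1) - u i| ^ (2 * H) - |v (j + 1) - u (i + 1)| ^ (2 * H))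
              - (|v j - u i| ^ (2 * H) - |v j - u (i + 1)| ^ (2 * H))| := by
            refine Finset.sum_congr rfl fun j _ => ?_
            rw [← abs_of_pos (one_half_pos (α := ℝ)), ← abs_mul]
            simp only [hR]
            congr 1
            ring
        _ ≤ _ := by rw [← Finset.mul_sum]; linarith
    refine (sum_rpow_le_of_sum_le hp (fun _ => abs_nonneg _) key).trans_eq ?_
    rw [Real.mul_rpow zero_le_two (Real.rpow_nonneg hd _), ← Real.rpow_mul hd,
      mul_one_div_cancel hα0.ne', Real.rpow_one]
  calc _ ≤ ∑ i ∈ Finset.range m, 2 ^ (1 / (2 * H)) * (u (i + 1) - u i) :=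
        Finset.sum_le_sum fun i hi => row i (Finset.mem_range.1 hi)
    _ = 2 ^ (1 / (2 * H)) * (t - s) := by
        rw [← Finset.mul_sum, Finset.sum_range_sub u m, hum, hu0]
end

section
/- Let H ∈ (0, 1/2), T > 0, n ∈ ℕ+, h = T/n, and t_i = ih for i = 0,…,n. Then ∑_{i=0}^{n−1} ∫_{t_i}^{t_{i+1}} [ ∫_0^{t_i} (u−v)^{2H−2} dv + ∫_{t_{i+1}}^T (v−u)^{2H−2} dv ] du = (1/(H(1−2H))) (n h^{2H} − T^{2H}); in particular, this quantity is at most (T/(H(1−2H))) h^{2H−1}. -/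
open MeasureTheory

/-- Integral of a shifted power over an interval lying to the left of the shift. -/
theorem intervalIntegral_sub_left_rpow {s a b u : ℝ} (hs : s ≠ 1) (hau : a < u) (hbu : b < u) :
    ∫ v in a..b, (u - v) ^ (s - 2) = ((u - a) ^ (s - 1) - (u - b) ^ (s - 1)) / (s - 1) := by
  rw [intervalIntegral.integral_comp_sub_left (fun x => x ^ (s - 2)) u, integral_rpow]
  · norm_num [show s - 2 + 1 = s - 1 by ring]
  · refine Or.inr ⟨fun h => hs (by linarith), fun h => ?_⟩
    have := (lt_inf_iff.2 ⟨sub_pos.2 hbu, sub_pos.2 hau⟩).trans_le h.1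
    exact lt_irrefl _ this

/-- Integral of a shifted power over an interval lying to the right of the shift. -/
theorem intervalIntegral_sub_right_rpow {s a b u : ℝ} (hs : s ≠ 1) (hua : u < a) (hub : u < b) :
    ∫ v in a..b, (v - u) ^ (s - 2) = ((b - u) ^ (s - 1) - (a - u) ^ (s - 1)) / (s - 1) := by
  rw [intervalIntegral.integral_comp_sub_right (fun x => x ^ (s - 2)) u, integral_rpow]
  · norm_num [show s - 2 + 1 = s - 1 by ring]
  · refine Or.inr ⟨fun h => hs (by linarith), fun h => ?_⟩
    have := (lt_inf_iff.2 ⟨sub_pos.2 hua, sub_pos.2 hub⟩).trans_le h.1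
    exact lt_irrefl _ this

/-- The kernel `|u - v| ^ (s - 2)` integrated over `u ∈ [a, b]` and `v ∈ [0, T] \ [a, b]`. -/
theorem integral_rpow_kernel_off_diagonal {s a b T : ℝ} (hs0 : 0 < s) (hs1 : s ≠ 1)
    (ha : 0 ≤ a) (hab : a ≤ b) (hbT : b ≤ T) :
    ∫ u in a..b, ((∫ v in (0 : ℝ)..a, (u - v) ^ (s - 2)) + ∫ v in b..T, (v - u) ^ (s - 2))
      = (b ^ s - a ^ s + ((T - a) ^ s - (T - b) ^ s) - 2 * (b - a) ^ s) / (s * (s - 1)) := by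
  have hne : ∀ᵐ u : ℝ, u ≠ b := by simp [ae_iff]
  have hcongr :
      ∫ u in a..b, ((∫ v in (0 : ℝ)..a, (u - v) ^ (s - 2)) + ∫ v in b..T, (v - u) ^ (s - 2))
      = ∫ u in a..b, ((u ^ (s - 1) - (u - a) ^ (s - 1))
          + ((T - u) ^ (s - 1) - (b - u) ^ (s - 1))) / (s - 1) := by
    refine intervalIntegral.integral_congr_ae ?_
    filter_upwards [hne] with u hub hu
    rw [Set.uIoc_of_le hab] at hu
    have hub' : u < b := lt_of_le_of_ne hu.2 hub
    rw [intervalIntegral_sub_left_rpow hs1 (ha.trans_lt hu.1) hu.1,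
      intervalIntegral_sub_right_rpow hs1 hub' (hub'.trans_le hbT), sub_zero, add_div]
  have hr : -1 < s - 1 := by linarith
  have hint (c d : ℝ) : IntervalIntegrable (fun x : ℝ => x ^ (s - 1)) volume c d :=
    intervalIntegral.intervalIntegrable_rpow' hr
  have hright (c : ℝ) : IntervalIntegrable (fun u : ℝ => (u - c) ^ (s - 1)) volume a b := by
    simpa using (hint (a - c) (b - c)).comp_sub_right c
  have hleft (c : ℝ) : IntervalIntegrable (fun u : ℝ => (c - u) ^ (s - 1)) volume a b := by
    simpa using (hint (c - a) (c - b)).comp_sub_left c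
  rw [hcongr, intervalIntegral.integral_div, intervalIntegral.integral_add
      ((hint a b).sub (hright a)) ((hleft T).sub (hleft b)),
    intervalIntegral.integral_sub (hint a b) (hright a),
    intervalIntegral.integral_sub (hleft T) (hleft b),
    intervalIntegral.integral_comp_sub_right (fun x => x ^ (s - 1)) a,
    intervalIntegral.integral_comp_sub_left (fun x => x ^ (s - 1)) T,
    intervalIntegral.integral_comp_sub_left (fun x => x ^ (s - 1)) b,
    integral_rpow (Or.inl hr), integral_rpow (Or.inl hr), integral_rpow (Or.inl hr),
    integral_rpow (Or.inl hr)]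
  have hs1' : s - 1 ≠ 0 := sub_ne_zero.2 hs1
  simp only [sub_add_cancel, sub_self, Real.zero_rpow hs0.ne']
  field_simp
  ring


/-- For `H ∈ (0,1/2)`, `T > 0`, `n ∈ ℕ₊`, `h = T/n`, `t_i = ih`:
`∑_{i=0}^{n−1} ∫_{t_i}^{t_{i+1}} [∫_0^{t_i} (u−v)^{2H−2} dv + ∫_{t_{i+1}}^T (v−u)^{2H−2} dv] du
  = (1/(H(1−2H))) (n h^{2H} − T^{2H})`,
and in particular this quantity is at most `(T/(H(1−2H))) h^{2H−1}`. -/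
theorem fbm_kernel_grid_sum_eq_and_bound
    (H T : ℝ) (n : ℕ) (hH0 : 0 < H) (hH : H < 1/2) (hT : 0 < T) (hn : 0 < n)
    (h : ℝ) (hh : h = T / n) :
    (∑ i ∈ Finset.range n, ∫ u in ((i : ℝ) * h)..(((i : ℝ) + 1) * h),
        ((∫ v in (0:ℝ)..((i : ℝ) * h), (u - v) ^ (2*H - 2))
          + ∫ v in (((i : ℝ) + 1) * h)..T, (v - u) ^ (2*H - 2)))
      = (1 / (H * (1 - 2*H))) * ((n : ℝ) * h ^ (2*H) - T ^ (2*H))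
    ∧ (∑ i ∈ Finset.range n, ∫ u in ((i : ℝ) * h)..(((i : ℝ) + 1) * h),
        ((∫ v in (0:ℝ)..((i : ℝ) * h), (u - v) ^ (2*H - 2))
          + ∫ v in (((i : ℝ) + 1) * h)..T, (v - u) ^ (2*H - 2)))
      ≤ (T / (H * (1 - 2*H))) * h ^ (2*H - 1) := by
  have hnR : (0 : ℝ) < n := Nat.cast_pos.2 hn
  have hpos : 0 < h := hh ▸ div_pos hT hnR
  have hnh : (n : ℝ) * h = T := by rw [hh]; field_simp
  have hden : 0 < H * (1 - 2 * H) := mul_pos hH0 (by linarith)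
  have heq : (∑ i ∈ Finset.range n, ∫ u in ((i : ℝ) * h)..(((i : ℝ) + 1) * h),
        ((∫ v in (0:ℝ)..((i : ℝ) * h), (u - v) ^ (2*H - 2))
          + ∫ v in (((i : ℝ) + 1) * h)..T, (v - u) ^ (2*H - 2)))
      = (1 / (H * (1 - 2*H))) * ((n : ℝ) * h ^ (2*H) - T ^ (2*H)) := by
    have hterm : ∀ i ∈ Finset.range n, (∫ u in ((i : ℝ) * h)..(((i : ℝ) + 1) * h),
        ((∫ v in (0:ℝ)..((i : ℝ) * h), (u - v) ^ (2*H - 2))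
          + ∫ v in (((i : ℝ) + 1) * h)..T, (v - u) ^ (2*H - 2)))
        = (((((i + 1 : ℕ) : ℝ) * h) ^ (2*H) - (T - ((i + 1 : ℕ) : ℝ) * h) ^ (2*H)
            - (((i : ℝ) * h) ^ (2*H) - (T - (i : ℝ) * h) ^ (2*H)))
            - 2 * h ^ (2*H)) / (2*H * (2*H - 1)) := by
      intro i hi
      have hin : (i : ℝ) + 1 ≤ n := by exact_mod_cast Finset.mem_range.1 hi
      rw [integral_rpow_kernel_off_diagonal (by linarith) (by linarith) (by positivity)
        (by nlinarith) (hnh ▸ mul_le_mul_of_nonneg_right hin hpos.le),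
        show ((i : ℝ) + 1) * h - i * h = h by ring]
      push_cast
      ring
    rw [Finset.sum_congr rfl hterm, ← Finset.sum_div, Finset.sum_sub_distrib,
      Finset.sum_range_sub (fun i : ℕ => ((i : ℝ) * h) ^ (2*H) - (T - (i : ℝ) * h) ^ (2*H)),
      Finset.sum_const, Finset.card_range, nsmul_eq_mul, hnh, sub_self, Nat.cast_zero, zero_mul,
      sub_zero, Real.zero_rpow (by linarith)]
    have h₁ : 2 * H - 1 ≠ 0 := by linarith
    have h₂ : 1 - 2 * H ≠ 0 := by linarith
    field_simp
    ring
  refine ⟨heq, heq.trans_le ?_⟩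
  have hpow : (n : ℝ) * h ^ (2*H) = T * h ^ (2*H - 1) := by
    rw [Real.rpow_sub_one hpos.ne', ← hnh]
    field_simp
  rw [hpow, div_mul_eq_mul_div, div_mul_eq_mul_div, one_mul]
  gcongr
  exact sub_le_self _ (by positivity)
end

section
/- Let (Ω, F, P) be a probability space, H ∈ (0,1), T > 0, and let B : [0,T] → Ω → ℝ be a stochastic process such that for all 0 ≤ s ≤ t ≤ T, the law under P of the increment ω ↦ B_t(ω) − B_s(ω) is the centered Gaussian measure on ℝ with variance (t−s)^{2H}. Then for every β ∈ (0, H) there exists a modification B̃ of B (i.e., a process with P(B̃_t = B_t) = 1 for every t ∈ [0,T]) such that almost every sample path t ↦ B̃_t(ω) is β-Hölder continuous on [0,T], and the random β-Hölder seminorm ω ↦ sup_{0 ≤ u < v ≤ T} |B̃_v(ω) − B̃_u(ω)| / (v−u)^β lies in L^p(Ω, P) for every p ≥ 1. -/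
open MeasureTheory ProbabilityTheory Filter Topology ENNReal

/-- The increments of `f` over the `n`-th dyadic grid of `[0,T]` are bounded by `M * r ^ n`. -/
def DyadicIncrementBound (f : ℝ → ℝ) (T r M : ℝ) : Prop :=
  ∀ n k : ℕ, k < 2 ^ n → |f ((k + 1 : ℕ) * T / 2 ^ n) - f (k * T / 2 ^ n)| ≤ M * r ^ n

/-- The largest point of the `n`-th dyadic grid of `[0,T]` that is at most `t`. -/
noncomputable def dyadicFloor (T t : ℝ) (n : ℕ) : ℝ := ⌊t * 2 ^ n / T⌋₊ * T / 2 ^ n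

/-- The limit of the values of `f` along the dyadic points approximating `t` from below. -/
noncomputable def dyadicLim (f : ℝ → ℝ) (T t : ℝ) : ℝ :=
  limUnder atTop fun n => f (dyadicFloor T t n)

section Deterministic

variable {Ω : Type*} {f : ℝ → ℝ} {H T r M t a β : ℝ}

lemma dyadicFloor_nonneg (hT : 0 < T) (n : ℕ) : 0 ≤ dyadicFloor T t n := by
  unfold dyadicFloor; positivity

lemma dyadicFloor_le (hT : 0 < T) (ht : 0 ≤ t) (n : ℕ) : dyadicFloor T t n ≤ t := by
  unfold dyadicFloor
  have h := Nat.floor_le (show 0 ≤ t * 2 ^ n / T by positivity)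
  rw [le_div_iff₀ hT] at h
  rwa [div_le_iff₀ (by positivity)]

lemma sub_dyadicFloor_le (hT : 0 < T) (n : ℕ) : t - dyadicFloor T t n ≤ T * (1 / 2) ^ n := by
  unfold dyadicFloor
  have h := Nat.lt_floor_add_one (t * 2 ^ n / T)
  rw [div_lt_iff₀ hT, ← lt_div_iff₀ (by positivity)] at h
  have e : T * (1 / 2) ^ n = T / 2 ^ n := by simp [div_eq_mul_inv]
  rw [e]
  rw [add_mul, one_mul, add_div] at h
  linarith

lemma tendsto_sub_dyadicFloor (hT : 0 < T) (ht : 0 ≤ t) :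
    Tendsto (fun n => t - dyadicFloor T t n) atTop (𝓝 0) := by
  have h : Tendsto (fun n : ℕ => T * (1 / 2 : ℝ) ^ n) atTop (𝓝 0) := by
    simpa using (tendsto_pow_atTop_nhds_zero_of_lt_one (r := (1 / 2 : ℝ))
      (by norm_num) (by norm_num)).const_mul T
  exact squeeze_zero (fun n => sub_nonneg.2 (dyadicFloor_le hT ht n))
    (fun n => sub_dyadicFloor_le hT n) h

lemma floor_dyadic_le (hT : 0 < T) (htT : t ≤ T) (n : ℕ) : ⌊t * 2 ^ n / T⌋₊ ≤ 2 ^ n := by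
  apply Nat.floor_le_of_le
  rw [div_le_iff₀ hT]
  push_cast
  nlinarith [pow_pos (two_pos : (0 : ℝ) < 2) n]

lemma DyadicIncrementBound.abs_sub_le (h : DyadicIncrementBound f T r M) (hr : 0 ≤ r)
    (hM : 0 ≤ M) {n i j : ℕ} (hij : i ≤ j) (hji : j ≤ i + 1) (hj : j ≤ 2 ^ n) :
    |f (j * T / 2 ^ n) - f (i * T / 2 ^ n)| ≤ M * r ^ n := by
  obtain rfl | rfl : j = i ∨ j = i + 1 := by omega
  · simp only [sub_self, abs_zero]; positivity
  · exact h n i (by omega)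

lemma DyadicIncrementBound.dist_le (h : DyadicIncrementBound f T r M) (hT : 0 < T) (hr : 0 ≤ r)
    (hr1 : r ≤ 1) (hM : 0 ≤ M) (ht : 0 ≤ t) (htT : t ≤ T) (n : ℕ) :
    dist (f (dyadicFloor T t n)) (f (dyadicFloor T t (n + 1))) ≤ M * r ^ n := by
  set x := t * 2 ^ n / T with hx
  have hx0 : 0 ≤ x := by positivity
  have hx2 : t * 2 ^ (n + 1) / T = 2 * x := by rw [hx]; ring
  have h1 : 2 * ⌊x⌋₊ ≤ ⌊2 * x⌋₊ := by
    apply Nat.le_floor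
    push_cast
    linarith [Nat.floor_le hx0]
  have h2 : ⌊2 * x⌋₊ ≤ 2 * ⌊x⌋₊ + 1 := by
    rw [← Nat.lt_succ_iff, Nat.floor_lt (by positivity)]
    push_cast
    linarith [Nat.lt_floor_add_one x]
  have h3 : ⌊2 * x⌋₊ ≤ 2 ^ (n + 1) := hx2 ▸ floor_dyadic_le hT htT (n + 1)
  have key := h.abs_sub_le hr hM h1 h2 h3
  have e1 : dyadicFloor T t n = (2 * ⌊x⌋₊ : ℕ) * T / 2 ^ (n + 1) := by
    unfold dyadicFloor
    rw [← hx]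
    push_cast
    field_simp
    ring
  have e2 : dyadicFloor T t (n + 1) = ⌊2 * x⌋₊ * T / 2 ^ (n + 1) := by
    unfold dyadicFloor
    rw [hx2]
  rw [dist_comm, Real.dist_eq, e1, e2]
  exact key.trans (mul_le_mul_of_nonneg_left (pow_le_pow_of_le_one hr hr1 n.le_succ) hM)

lemma DyadicIncrementBound.tendsto_dyadicLim (h : DyadicIncrementBound f T r M) (hT : 0 < T)
    (hr : 0 ≤ r) (hr1 : r < 1) (hM : 0 ≤ M) (ht : 0 ≤ t) (htT : t ≤ T) :
    Tendsto (fun n => f (dyadicFloor T t n)) atTop (𝓝 (dyadicLim f T t)) :=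
  CauchySeq.tendsto_limUnder (cauchySeq_of_le_geometric r M hr1 (h.dist_le hT hr hr1.le hM ht htT))

/-- Dyadic increments bounded by a multiple of `2 ^ (-β n)` force the limit along dyadic points
to be `β`-Hölder continuous. -/
lemma DyadicIncrementBound.abs_dyadicLim_sub_le {u v : ℝ}
    (h : DyadicIncrementBound f T ((1 / 2) ^ β) M) (hT : 0 < T) (hβ : 0 < β) (hM : 0 ≤ M)
    (hu : 0 ≤ u) (huv : u < v) (hv : v ≤ T) :
    |dyadicLim f T v - dyadicLim f T u| ≤
      (2 / (1 - (1 / 2) ^ β) + 1) * 2 ^ β * (T ^ β)⁻¹ * M * (v - u) ^ β := by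
  set r : ℝ := (1 / 2) ^ β with hrdef
  have hr : 0 < r := by positivity
  have hr1 : r < 1 := Real.rpow_lt_one (by norm_num) (by norm_num) hβ
  have hv0 : 0 ≤ v := hu.trans huv.le
  have huT : u ≤ T := huv.le.trans hv
  obtain ⟨n, hn1, hn2⟩ := exists_nat_pow_near_of_lt_one
    (show 0 < (v - u) / T from div_pos (by linarith) hT)
    (by rw [div_le_one hT]; linarith) (show (0 : ℝ) < 1 / 2 by norm_num) (by norm_num)
  have bu := dist_le_of_le_geometric_of_tendsto r M hr1 (h.dist_le hT hr.le hr1.le hM hu huT)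
    (h.tendsto_dyadicLim hT hr.le hr1 hM hu huT) n
  have bv := dist_le_of_le_geometric_of_tendsto r M hr1 (h.dist_le hT hr.le hr1.le hM hv0 hv)
    (h.tendsto_dyadicLim hT hr.le hr1 hM hv0 hv) n
  have h1 : ⌊u * 2 ^ n / T⌋₊ ≤ ⌊v * 2 ^ n / T⌋₊ := by
    apply Nat.floor_le_floor
    gcongr
  have h2 : ⌊v * 2 ^ n / T⌋₊ ≤ ⌊u * 2 ^ n / T⌋₊ + 1 := by
    rw [← Nat.floor_add_one (by positivity)]
    apply Nat.floor_le_floor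
    have : (v - u) / T * 2 ^ n ≤ 1 := by
      calc (v - u) / T * 2 ^ n ≤ (1 / 2) ^ n * 2 ^ n := by gcongr
        _ = 1 := by rw [← mul_pow]; norm_num
    have e : v * 2 ^ n / T = u * 2 ^ n / T + (v - u) / T * 2 ^ n := by ring
    linarith
  have bm : |f (dyadicFloor T v n) - f (dyadicFloor T u n)| ≤ M * r ^ n :=
    h.abs_sub_le hr.le hM h1 h2 (floor_dyadic_le hT hv n)
  have hrn : r ^ n ≤ 2 ^ β * ((T ^ β)⁻¹ * (v - u) ^ β) := by
    have e : r ^ n = 2 ^ β * ((1 / 2 : ℝ) ^ (n + 1)) ^ β := by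
      rw [← Real.rpow_natCast, ← Real.rpow_natCast (1 / 2), hrdef, ← Real.rpow_mul (by norm_num),
        ← Real.rpow_mul (by norm_num), one_div, Real.inv_rpow (by norm_num),
        Real.inv_rpow (by norm_num), ← Real.rpow_neg (by norm_num), ← Real.rpow_neg (by norm_num),
        ← Real.rpow_add (by norm_num)]
      congr 1
      push_cast
      ring
    have e2 : (T ^ β)⁻¹ * (v - u) ^ β = ((v - u) / T) ^ β := by
      rw [Real.div_rpow (by linarith) hT.le]; ring
    rw [e, e2]
    gcongr
  have hC : 0 ≤ 2 / (1 - r) + 1 := by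
    have : 0 < 1 - r := by linarith
    positivity
  rw [Real.dist_eq] at bu bv
  calc |dyadicLim f T v - dyadicLim f T u|
      ≤ |f (dyadicFloor T v n) - dyadicLim f T v| + |f (dyadicFloor T u n) - dyadicLim f T u|
        + |f (dyadicFloor T v n) - f (dyadicFloor T u n)| := by
        grind
    _ ≤ M * r ^ n / (1 - r) + M * r ^ n / (1 - r) + M * r ^ n := by gcongr
    _ = (2 / (1 - r) + 1) * M * r ^ n := by ring
    _ ≤ (2 / (1 - r) + 1) * M * (2 ^ β * ((T ^ β)⁻¹ * (v - u) ^ β)) := by gcongr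
    _ = _ := by ring

/-- The sum over all dyadic increments of `f` of their `q`-th powers, weighted by `a ^ (n * q)` at
level `n`. -/
noncomputable def dyadicSum (f : ℝ → ℝ) (T a : ℝ) (q : ℕ) : ℝ≥0∞ :=
  ∑' n : ℕ, ∑ k ∈ Finset.range (2 ^ n),
    ENNReal.ofReal (a ^ n) ^ q * ‖f ((k + 1 : ℕ) * T / 2 ^ n) - f (k * T / 2 ^ n)‖ₑ ^ q

lemma dyadicIncrementBound_of_dyadicSum {f : ℝ → ℝ} {q : ℕ} (ha : 0 < a) (hq : q ≠ 0)
    (hf : dyadicSum f T a q ≠ ∞) :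
    DyadicIncrementBound f T a⁻¹ ((dyadicSum f T a q).toReal ^ (q : ℝ)⁻¹) := by
  intro n k hk
  set d := f ((k + 1 : ℕ) * T / 2 ^ n) - f (k * T / 2 ^ n)
  have h1 : ENNReal.ofReal (a ^ n) ^ q * ‖d‖ₑ ^ q ≤ dyadicSum f T a q :=
    (Finset.single_le_sum (f := fun k : ℕ => ENNReal.ofReal (a ^ n) ^ q *
        ‖f ((k + 1 : ℕ) * T / 2 ^ n) - f (k * T / 2 ^ n)‖ₑ ^ q) (fun _ _ => zero_le)
      (Finset.mem_range.2 hk)).trans (ENNReal.le_tsum n)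
  have h2 := ENNReal.toReal_mono hf h1
  rw [← mul_pow, ENNReal.toReal_pow, ENNReal.toReal_mul, ENNReal.toReal_ofReal (by positivity),
    toReal_enorm, Real.norm_eq_abs] at h2
  have h3 := Real.rpow_le_rpow (by positivity) h2 (show 0 ≤ (q : ℝ)⁻¹ by positivity)
  rw [Real.pow_rpow_inv_natCast (by positivity) hq] at h3
  rw [inv_pow, ← div_eq_mul_inv, le_div_iff₀ (by positivity)]
  linarith

open Classical in
/-- The limit of `B` along dyadic points, on the event that the dyadic increments of `B` decay like
`2 ^ (-β n)`, and `0` elsewhere. -/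
noncomputable def holderModification (B : ℝ → Ω → ℝ) (T β t : ℝ) (ω : Ω) : ℝ :=
  if ∃ M, 0 ≤ M ∧ DyadicIncrementBound (fun t => B t ω) T ((1 / 2) ^ β) M
  then dyadicLim (fun t => B t ω) T t else 0

lemma abs_holderModification_sub_le (B : ℝ → Ω → ℝ) {u v M : ℝ} {ω : Ω}
    (hM : DyadicIncrementBound (fun t => B t ω) T ((1 / 2) ^ β) M) (hT : 0 < T) (hβ : 0 < β)
    (hM0 : 0 ≤ M) (hu : 0 ≤ u) (huv : u < v) (hv : v ≤ T) :
    |holderModification B T β v ω - holderModification B T β u ω| ≤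
      (2 / (1 - (1 / 2) ^ β) + 1) * 2 ^ β * (T ^ β)⁻¹ * M * (v - u) ^ β := by
  unfold holderModification
  rw [if_pos ⟨M, hM0, hM⟩, if_pos ⟨M, hM0, hM⟩]
  exact hM.abs_dyadicLim_sub_le hT hβ hM0 hu huv hv

lemma exists_abs_holderModification_sub_le (B : ℝ → Ω → ℝ) (hT : 0 < T) (hβ : 0 < β) (ω : Ω) :
    ∃ M, ∀ u ∈ Set.Icc (0 : ℝ) T, ∀ v ∈ Set.Icc (0 : ℝ) T,
      |holderModification B T β v ω - holderModification B T β u ω| ≤ M * |v - u| ^ β := by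
  by_cases h : ∃ M, 0 ≤ M ∧ DyadicIncrementBound (fun t => B t ω) T ((1 / 2) ^ β) M
  · obtain ⟨M, hM0, hM⟩ := h
    refine ⟨(2 / (1 - (1 / 2) ^ β) + 1) * 2 ^ β * (T ^ β)⁻¹ * M, fun u hu v hv => ?_⟩
    rcases lt_trichotomy u v with huv | rfl | hvu
    · rw [abs_of_pos (sub_pos.2 huv)]
      exact abs_holderModification_sub_le B hM hT hβ hM0 hu.1 huv hv.2
    · simp [Real.zero_rpow hβ.ne']
    · rw [abs_sub_comm, abs_sub_comm v, abs_of_pos (sub_pos.2 hvu)]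
      exact abs_holderModification_sub_le B hM hT hβ hM0 hv.1 hvu hu.2
  · exact ⟨0, fun u _ v _ => by
      rw [holderModification, holderModification, if_neg h, if_neg h, sub_self, abs_zero, zero_mul]⟩

/-- The set of Hölder quotients of exponent `β` of `f` on `[0,T]`. -/
def holderQuotients (f : ℝ → ℝ) (T β : ℝ) : Set ℝ :=
  {x | ∃ u v : ℝ, 0 ≤ u ∧ u < v ∧ v ≤ T ∧ x = |f v - f u| / (v - u) ^ β}

lemma sSup_holderQuotients_nonneg (f : ℝ → ℝ) : 0 ≤ sSup (holderQuotients f T β) := by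
  refine Real.sSup_nonneg ?_
  rintro x ⟨u, v, -, huv, -, rfl⟩
  have := sub_pos.2 huv
  positivity

lemma continuousOn_of_abs_sub_le {f : ℝ → ℝ} {S : Set ℝ} {M : ℝ} (hβ : 0 < β)
    (hf : ∀ u ∈ S, ∀ v ∈ S, |f v - f u| ≤ M * |v - u| ^ β) : ContinuousOn f S := by
  intro u hu
  have hlim : Tendsto (fun v => M * |v - u| ^ β) (𝓝[S] u) (𝓝 0) := by
    have : ContinuousAt (fun v => M * |v - u| ^ β) u := by
      refine continuousAt_const.mul (ContinuousAt.rpow_const (by fun_prop) (Or.inr hβ.le))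
    have h := this.tendsto
    simp only [sub_self, abs_zero, Real.zero_rpow hβ.ne', mul_zero] at h
    exact h.mono_left nhdsWithin_le_nhds
  rw [ContinuousWithinAt, tendsto_iff_dist_tendsto_zero]
  exact squeeze_zero' (Eventually.of_forall fun _ => dist_nonneg)
    (eventually_mem_nhdsWithin.mono fun v hv => hf u hu v hv) hlim

lemma exists_two_rpow_mul_pow_lt (hβH : β < H) (m : ℕ) :
    ∃ q : ℕ, m ≤ q ∧ q ≠ 0 ∧ ((2 : ℝ) ^ β * (1 / 2) ^ H) ^ q < 1 / 2 := by
  have hlt : (2 : ℝ) ^ β * (1 / 2) ^ H < 1 := by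
    rw [one_div, Real.inv_rpow (by norm_num), ← Real.rpow_neg (by norm_num),
      ← Real.rpow_add (by norm_num)]
    exact Real.rpow_lt_one_of_one_lt_of_neg (by norm_num) (by linarith)
  have h := (tendsto_pow_atTop_nhds_zero_of_lt_one (by positivity) hlt).eventually_lt_const
    (show (0 : ℝ) < 1 / 2 by norm_num)
  obtain ⟨q, h1, h2, h3⟩ := ((eventually_ge_atTop m).and ((eventually_ne_atTop 0).and h)).exists
  exact ⟨q, h1, h2, h3⟩

lemma two_rpow_inv (β : ℝ) : ((2 : ℝ) ^ β)⁻¹ = (1 / 2) ^ β := by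
  rw [one_div, Real.inv_rpow (by norm_num)]

end Deterministic

section Probability

variable {Ω : Type*} [MeasurableSpace Ω] {P : Measure Ω} {B X : ℝ → Ω → ℝ} {H T a β s t : ℝ}

/-- The absolute moment of order `q` of the standard Gaussian measure. -/
noncomputable def gaussianMoment (q : ℕ) : ℝ≥0∞ := ∫⁻ x, ‖x‖ₑ ^ q ∂gaussianReal 0 1

lemma gaussianMoment_lt_top {q : ℕ} (hq : q ≠ 0) : gaussianMoment q < ∞ := by
  have h := (memLp_id_gaussianReal (μ := 0) (v := 1) q).2
  rw [eLpNorm_lt_top_iff_lintegral_rpow_enorm_lt_top (by simpa using hq) (by simp)] at h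
  simpa [gaussianMoment] using h

lemma lintegral_enorm_pow_gaussianReal (hs : 0 ≤ s) (q : ℕ) :
    ∫⁻ x, ‖x‖ₑ ^ q ∂gaussianReal 0 (s ^ (2 * H)).toNNReal
      = ENNReal.ofReal (s ^ H) ^ q * gaussianMoment q := by
  have hmap := gaussianReal_map_const_mul (μ := 0) (v := 1) (s ^ H)
  have hv : NNReal.mk ((s ^ H) ^ 2) (sq_nonneg _) * 1 = (s ^ (2 * H)).toNNReal := by
    ext
    rw [Real.coe_toNNReal _ (by positivity)]
    simp only [mul_one, NNReal.coe_mk]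
    rw [← Real.rpow_natCast, ← Real.rpow_mul hs]
    congr 1
    push_cast
    ring
  rw [mul_zero, hv] at hmap
  rw [← hmap, lintegral_map (by fun_prop) (by fun_prop), gaussianMoment,
    ← lintegral_const_mul _ (by fun_prop)]
  refine lintegral_congr fun x => ?_
  rw [enorm_mul, mul_pow, Real.enorm_of_nonneg (by positivity)]

/-- On `[0,T]`, the increments of `B` are centered Gaussian with variance `(t - s) ^ (2 * H)`. -/
def HasFractionalIncrements (B : ℝ → Ω → ℝ) (H T : ℝ) (P : Measure Ω) : Prop :=
  ∀ s t : ℝ, 0 ≤ s → s ≤ t → t ≤ T →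
    P.map (fun ω => B t ω - B s ω) = gaussianReal 0 (Real.toNNReal ((t - s) ^ (2 * H)))

namespace HasFractionalIncrements

lemma aemeasurable_sub (hB : HasFractionalIncrements B H T P) (hs : 0 ≤ s) (hst : s ≤ t)
    (ht : t ≤ T) : AEMeasurable (fun ω => B t ω - B s ω) P :=
  AEMeasurable.of_map_ne_zero (by rw [hB s t hs hst ht]; exact IsProbabilityMeasure.ne_zero _)

lemma lintegral_enorm_sub_pow (hB : HasFractionalIncrements B H T P) (hs : 0 ≤ s) (hst : s ≤ t)
    (ht : t ≤ T) (q : ℕ) :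
    ∫⁻ ω, ‖B t ω - B s ω‖ₑ ^ q ∂P = ENNReal.ofReal ((t - s) ^ H) ^ q * gaussianMoment q := by
  rw [← lintegral_enorm_pow_gaussianReal (sub_nonneg.2 hst), ← hB s t hs hst ht,
    lintegral_map' (by fun_prop) (hB.aemeasurable_sub hs hst ht)]

lemma aemeasurable_dyadic (hB : HasFractionalIncrements B H T P) (hT : 0 < T) {n k : ℕ}
    (hk : k < 2 ^ n) :
    AEMeasurable (fun ω => B ((k + 1 : ℕ) * T / 2 ^ n) ω - B (k * T / 2 ^ n) ω) P := by
  have hk' : ((k + 1 : ℕ) : ℝ) ≤ 2 ^ n := by exact_mod_cast hk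
  refine hB.aemeasurable_sub (by positivity) (by gcongr; simp) ?_
  rw [div_le_iff₀ (by positivity), mul_comm]
  gcongr

lemma lintegral_dyadic (hB : HasFractionalIncrements B H T P) (hT : 0 < T) {n k : ℕ}
    (hk : k < 2 ^ n) (q : ℕ) :
    ∫⁻ ω, ‖B ((k + 1 : ℕ) * T / 2 ^ n) ω - B (k * T / 2 ^ n) ω‖ₑ ^ q ∂P
      = ENNReal.ofReal (T ^ H * ((1 / 2) ^ H) ^ n) ^ q * gaussianMoment q := by
  have hk' : ((k + 1 : ℕ) : ℝ) ≤ 2 ^ n := by exact_mod_cast hk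
  rw [hB.lintegral_enorm_sub_pow (by positivity) (by gcongr; simp)
    (by rw [div_le_iff₀ (by positivity), mul_comm]; gcongr)]
  congr 3
  have e : ((k + 1 : ℕ) : ℝ) * T / 2 ^ n - k * T / 2 ^ n = T * (1 / 2) ^ n := by
    push_cast
    rw [one_div, inv_pow]
    ring
  rw [e, Real.mul_rpow hT.le (by positivity), ← Real.rpow_natCast, ← Real.rpow_natCast,
    ← Real.rpow_mul (by norm_num), ← Real.rpow_mul (by norm_num), mul_comm H]

lemma aemeasurable_dyadicSum (hB : HasFractionalIncrements B H T P) (hT : 0 < T) (q : ℕ) :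
    AEMeasurable (fun ω => dyadicSum (fun t => B t ω) T a q) P := by
  unfold dyadicSum
  refine AEMeasurable.tsum fun n => Finset.aemeasurable_fun_sum _ fun k hk => ?_
  exact ((hB.aemeasurable_dyadic hT (Finset.mem_range.1 hk)).enorm.pow_const q).const_mul _

lemma lintegral_dyadicSum_lt_top (hB : HasFractionalIncrements B H T P) (hT : 0 < T) (ha : 0 < a)
    {q : ℕ} (hq : q ≠ 0) (hsmall : (a * (1 / 2) ^ H) ^ q < 1 / 2) :
    ∫⁻ ω, dyadicSum (fun t => B t ω) T a q ∂P < ∞ := by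
  set b : ℝ := (1 / 2) ^ H with hb
  have hb0 : 0 < b := by positivity
  have hmeas (n k : ℕ) (hk : k ∈ Finset.range (2 ^ n)) : AEMeasurable (fun ω =>
      ‖B ((k + 1 : ℕ) * T / 2 ^ n) ω - B (k * T / 2 ^ n) ω‖ₑ ^ q) P :=
    (hB.aemeasurable_dyadic hT (Finset.mem_range.1 hk)).enorm.pow_const q
  have hterm (n : ℕ) : ∫⁻ ω, ∑ k ∈ Finset.range (2 ^ n), ENNReal.ofReal (a ^ n) ^ q *
        ‖B ((k + 1 : ℕ) * T / 2 ^ n) ω - B (k * T / 2 ^ n) ω‖ₑ ^ q ∂P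
      = ENNReal.ofReal (T ^ H) ^ q * gaussianMoment q
        * ENNReal.ofReal (2 * (a * b) ^ q) ^ n := by
    rw [lintegral_finsetSum' _ fun k hk => (hmeas n k hk).const_mul _]
    have : ∀ k ∈ Finset.range (2 ^ n), ∫⁻ ω, ENNReal.ofReal (a ^ n) ^ q *
        ‖B ((k + 1 : ℕ) * T / 2 ^ n) ω - B (k * T / 2 ^ n) ω‖ₑ ^ q ∂P =
        ENNReal.ofReal (a ^ n) ^ q *
          (ENNReal.ofReal (T ^ H * b ^ n) ^ q * gaussianMoment q) := fun k hk => by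
      rw [lintegral_const_mul'' _ (hmeas n k hk),
        hB.lintegral_dyadic hT (Finset.mem_range.1 hk)]
    rw [Finset.sum_congr rfl this, Finset.sum_const, Finset.card_range, nsmul_eq_mul,
      ENNReal.ofReal_mul (by positivity), ENNReal.ofReal_mul (by positivity),
      ENNReal.ofReal_pow (by positivity), ENNReal.ofReal_pow (by positivity),
      ENNReal.ofReal_pow (by positivity), ENNReal.ofReal_mul (by positivity)]
    push_cast
    rw [show ENNReal.ofReal 2 = 2 by simp]
    ring
  unfold dyadicSum
  rw [lintegral_tsum fun n => Finset.aemeasurable_fun_sum _ fun k hk => (hmeas n k hk).const_mul _]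
  simp_rw [hterm]
  rw [ENNReal.tsum_mul_left, ENNReal.tsum_geometric]
  refine ENNReal.mul_lt_top (ENNReal.mul_lt_top (by simp) (gaussianMoment_lt_top hq)) ?_
  rw [ENNReal.inv_lt_top, tsub_pos_iff_lt, ENNReal.ofReal_lt_one]
  linarith

lemma tendstoInMeasure_dyadicFloor (hB : HasFractionalIncrements B H T P) (hT : 0 < T)
    (hH : 0 < H) (ht : 0 ≤ t) (htT : t ≤ T) :
    TendstoInMeasure P (fun n ω => B t ω - B (dyadicFloor T t n) ω) atTop 0 := by
  have hm (n : ℕ) : AEMeasurable (fun ω => B t ω - B (dyadicFloor T t n) ω) P :=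
    hB.aemeasurable_sub (dyadicFloor_nonneg hT n) (dyadicFloor_le hT ht n) htT
  refine tendstoInMeasure_of_tendsto_eLpNorm one_ne_zero (fun n => (hm n).aestronglyMeasurable)
    aestronglyMeasurable_zero ?_
  have e (n : ℕ) : eLpNorm ((fun ω => B t ω - B (dyadicFloor T t n) ω) - 0) 1 P
      = ENNReal.ofReal ((t - dyadicFloor T t n) ^ H) * gaussianMoment 1 := by
    rw [sub_zero, eLpNorm_one_eq_lintegral_enorm]
    simpa using hB.lintegral_enorm_sub_pow (dyadicFloor_nonneg hT n) (dyadicFloor_le hT ht n)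
      htT 1
  simp_rw [e]
  have h1 : Tendsto (fun n => (t - dyadicFloor T t n) ^ H) atTop (𝓝 0) := by
    simpa [Real.zero_rpow hH.ne'] using
      (tendsto_sub_dyadicFloor hT ht).rpow_const (p := H) (Or.inr hH.le)
  have h2 := ENNReal.Tendsto.mul_const (b := gaussianMoment 1) (ENNReal.tendsto_ofReal h1)
    (Or.inr (gaussianMoment_lt_top one_ne_zero).ne)
  simpa using h2

end HasFractionalIncrements

lemma aemeasurable_sSup_holderQuotients
    (hcont : ∀ ω, ContinuousOn (fun t => X t ω) (Set.Icc 0 T))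
    (hmeas : ∀ u v, 0 ≤ u → u ≤ v → v ≤ T → AEMeasurable (fun ω => X v ω - X u ω) P) :
    AEMeasurable (fun ω => sSup (holderQuotients (fun t => X t ω) T β)) P := by
  let D := {p : ℝ × ℝ // 0 ≤ p.1 ∧ p.1 < p.2 ∧ p.2 ≤ T}
  let q (ω : Ω) (p : D) : ℝ := |X p.1.2 ω - X p.1.1 ω| / (p.1.2 - p.1.1) ^ β
  have hq (ω : Ω) : Continuous (q ω) := by
    have hX {g : D → ℝ} (hg : Continuous g) (hgT : ∀ p, g p ∈ Set.Icc 0 T) :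
        Continuous fun p => X (g p) ω :=
      (hcont ω).comp_continuous hg hgT
    have hpos (p : D) : 0 < p.1.2 - p.1.1 := sub_pos.2 p.2.2.1
    refine Continuous.div (continuous_abs.comp (Continuous.sub
      (hX (by fun_prop) fun p => ⟨p.2.1.trans p.2.2.1.le, p.2.2.2⟩)
      (hX (by fun_prop) fun p => ⟨p.2.1, p.2.2.1.le.trans p.2.2.2⟩)))
      (Continuous.rpow_const (by fun_prop) fun p => Or.inl (hpos p).ne')
      fun p => (Real.rpow_pos_of_pos (hpos p) β).ne'
  obtain ⟨S, hSc, hS⟩ := TopologicalSpace.exists_countable_dense D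
  have : Countable S := hSc.to_subtype
  have e (ω : Ω) : sSup (holderQuotients (fun t => X t ω) T β) = ⨆ p : S, q ω p := by
    rw [hS.ciSup' (hq ω), iSup]
    congr 1
    ext x
    constructor
    · rintro ⟨u, v, hu, huv, hv, rfl⟩
      exact ⟨⟨(u, v), hu, huv, hv⟩, rfl⟩
    · rintro ⟨⟨⟨u, v⟩, hu, huv, hv⟩, rfl⟩
      exact ⟨u, v, hu, huv, hv, rfl⟩
  simp_rw [e]
  refine AEMeasurable.iSup fun p => ?_
  have h := hmeas _ _ p.1.2.1 p.1.2.2.1.le p.1.2.2.2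
  exact (continuous_abs.measurable.comp_aemeasurable h).div_const _

namespace HasFractionalIncrements

lemma ae_dyadicSum_lt_top (hB : HasFractionalIncrements B H T P) (hT : 0 < T) (ha : 0 < a)
    {q : ℕ} (hq : q ≠ 0) (hsmall : (a * (1 / 2) ^ H) ^ q < 1 / 2) :
    ∀ᵐ ω ∂P, dyadicSum (fun t => B t ω) T a q < ∞ :=
  ae_lt_top' (hB.aemeasurable_dyadicSum hT q) (hB.lintegral_dyadicSum_lt_top hT ha hq hsmall).ne

variable [IsProbabilityMeasure P]

lemma holderModification_ae_eq (hB : HasFractionalIncrements B H T P) (hT : 0 < T) (hβ : 0 < β)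
    (hβH : β < H) (ht : 0 ≤ t) (htT : t ≤ T) :
    ∀ᵐ ω ∂P, holderModification B T β t ω = B t ω := by
  obtain ⟨q, -, hq, hsmall⟩ := exists_two_rpow_mul_pow_lt hβH 0
  have hm (n : ℕ) : AEMeasurable (fun ω => B t ω - B (dyadicFloor T t n) ω) P :=
    hB.aemeasurable_sub (dyadicFloor_nonneg hT n) (dyadicFloor_le hT ht n) htT
  have hlim : ∀ᵐ ω ∂P, Tendsto (fun n => B t ω - B (dyadicFloor T t n) ω) atTop
      (𝓝 (B t ω - holderModification B T β t ω)) := by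
    filter_upwards [hB.ae_dyadicSum_lt_top hT (by positivity) hq hsmall] with ω hω
    have hd := dyadicIncrementBound_of_dyadicSum (by positivity) hq hω.ne
    rw [two_rpow_inv] at hd
    unfold holderModification
    rw [if_pos ⟨_, by positivity, hd⟩]
    exact tendsto_const_nhds.sub (hd.tendsto_dyadicLim hT (by positivity)
      (Real.rpow_lt_one (by norm_num) (by norm_num) hβ) (by positivity) ht htT)
  have h1 := tendstoInMeasure_of_tendsto_ae (fun n => (hm n).aestronglyMeasurable) hlim
  have h2 := hB.tendstoInMeasure_dyadicFloor hT (hβ.trans hβH) ht htT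
  filter_upwards [tendstoInMeasure_ae_unique h1 h2] with ω hω
  simp only [Pi.zero_apply] at hω
  linarith

lemma memLp_sSup_holderQuotients (hB : HasFractionalIncrements B H T P) (hT : 0 < T) (hβ : 0 < β)
    (hβH : β < H) (p : ℝ) :
    MemLp (fun ω => sSup (holderQuotients (fun t => holderModification B T β t ω) T β))
      (ENNReal.ofReal p) P := by
  obtain ⟨q, hpq, hq, hsmall⟩ := exists_two_rpow_mul_pow_lt hβH ⌈p⌉₊
  set C : ℝ := (2 / (1 - (1 / 2) ^ β) + 1) * 2 ^ β * (T ^ β)⁻¹ with hCdef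
  have hC : 0 ≤ C := by
    have : 0 < 1 - (1 / 2 : ℝ) ^ β :=
      sub_pos.2 (Real.rpow_lt_one (by norm_num) (by norm_num) hβ)
    positivity
  have hmeas : AEMeasurable
      (fun ω => sSup (holderQuotients (fun t => holderModification B T β t ω) T β)) P := by
    refine aemeasurable_sSup_holderQuotients (fun ω => ?_) fun u v hu huv hv => ?_
    · obtain ⟨M, hM⟩ := exists_abs_holderModification_sub_le B hT hβ ω
      exact continuousOn_of_abs_sub_le hβ hM
    · refine (hB.aemeasurable_sub hu huv hv).congr ?_
      filter_upwards [hB.holderModification_ae_eq hT hβ hβH hu (huv.trans hv),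
        hB.holderModification_ae_eq hT hβ hβH (hu.trans huv) hv] with ω h1 h2
      rw [h1, h2]
  have hmem : MemLp
      (fun ω => sSup (holderQuotients (fun t => holderModification B T β t ω) T β)) q P := by
    refine ⟨hmeas.aestronglyMeasurable, ?_⟩
    rw [eLpNorm_lt_top_iff_lintegral_rpow_enorm_lt_top (by simpa using hq) (by simp)]
    simp only [ENNReal.toReal_natCast, ENNReal.rpow_natCast]
    calc ∫⁻ ω, ‖sSup (holderQuotients (fun t => holderModification B T β t ω) T β)‖ₑ ^ q ∂P
        ≤ ∫⁻ ω, ENNReal.ofReal C ^ q * dyadicSum (fun t => B t ω) T (2 ^ β) q ∂P := by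
          refine lintegral_mono_ae ?_
          filter_upwards [hB.ae_dyadicSum_lt_top hT (by positivity) hq hsmall] with ω hω
          have hd := dyadicIncrementBound_of_dyadicSum (by positivity) hq hω.ne
          rw [two_rpow_inv] at hd
          set W := dyadicSum (fun t => B t ω) T (2 ^ β) q with hW
          have hle : sSup (holderQuotients (fun t => holderModification B T β t ω) T β)
              ≤ C * W.toReal ^ (q : ℝ)⁻¹ := by
            refine Real.sSup_le ?_ (by positivity)
            rintro x ⟨u, v, hu, huv, hv, rfl⟩
            rw [div_le_iff₀ (Real.rpow_pos_of_pos (sub_pos.2 huv) β)]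
            exact abs_holderModification_sub_le B hd hT hβ (by positivity) hu huv hv
          rw [Real.enorm_of_nonneg (sSup_holderQuotients_nonneg _)]
          calc _ ≤ ENNReal.ofReal (C * W.toReal ^ (q : ℝ)⁻¹) ^ q := by gcongr
            _ = _ := by
              rw [ENNReal.ofReal_mul hC, mul_pow,
                ← ENNReal.ofReal_pow (p := W.toReal ^ (q : ℝ)⁻¹) (by positivity),
                Real.rpow_inv_natCast_pow (by positivity) hq, ENNReal.ofReal_toReal hω.ne]
      _ = ENNReal.ofReal C ^ q * ∫⁻ ω, dyadicSum (fun t => B t ω) T (2 ^ β) q ∂P :=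
          lintegral_const_mul'' _ (hB.aemeasurable_dyadicSum hT q)
      _ < ∞ := ENNReal.mul_lt_top (by simp)
          (hB.lintegral_dyadicSum_lt_top hT (by positivity) hq hsmall)
  refine hmem.mono_exponent ?_
  rw [← ENNReal.ofReal_natCast]
  exact ENNReal.ofReal_le_ofReal ((Nat.le_ceil p).trans (by exact_mod_cast hpq))

end HasFractionalIncrements

end Probability

/-- Let `B` be a process on a probability space whose increments
`B_t − B_s` (for `0 ≤ s ≤ t ≤ T`) are centered Gaussian with variance `(t−s)^{2H}`,
`H ∈ (0,1)`.  Then for every `β ∈ (0,H)` there is a modification `B̃` of `B` such that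
almost every sample path is `β`-Hölder continuous on `[0,T]`, and the random `β`-Hölder
seminorm `ω ↦ sup_{0 ≤ u < v ≤ T} |B̃_v(ω) − B̃_u(ω)|/(v−u)^β` lies in `L^p(Ω,P)` for
every `p ≥ 1`. -/
theorem fbm_holder_modification
    {Ω : Type*} [MeasurableSpace Ω] (P : Measure Ω) [IsProbabilityMeasure P]
    (H T : ℝ) (hH0 : 0 < H) (hH1 : H < 1) (hT : 0 < T)
    (B : ℝ → Ω → ℝ)
    (hlaw : ∀ s t : ℝ, 0 ≤ s → s ≤ t → t ≤ T →
      P.map (fun ω => B t ω - B s ω)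
        = gaussianReal 0 (Real.toNNReal ((t - s) ^ (2*H)))) :
    ∀ β : ℝ, 0 < β → β < H →
      ∃ Btl : ℝ → Ω → ℝ,
        (∀ t ∈ Set.Icc (0:ℝ) T, P {ω | Btl t ω = B t ω} = 1) ∧
        (∀ᵐ ω ∂P, ∃ M : ℝ, ∀ u ∈ Set.Icc (0:ℝ) T, ∀ v ∈ Set.Icc (0:ℝ) T,
          |Btl v ω - Btl u ω| ≤ M * |v - u| ^ β) ∧
        (∀ p : ℝ, 1 ≤ p →
          MemLp (fun ω => sSup { x : ℝ | ∃ u v : ℝ, 0 ≤ u ∧ u < v ∧ v ≤ T ∧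
              x = |Btl v ω - Btl u ω| / (v - u) ^ β }) (ENNReal.ofReal p) P) := by
  intro β hβ hβH
  have hB : HasFractionalIncrements B H T P := hlaw
  refine ⟨holderModification B T β, fun t ht => ?_,
    Eventually.of_forall (exists_abs_holderModification_sub_le B hT hβ),
    fun p _ => hB.memLp_sSup_holderQuotients hT hβ hβH p⟩
  rw [← measure_univ (μ := P)]
  exact measure_congr (eventuallyEq_univ.2 (hB.holderModification_ae_eq hT hβ hβH ht.1 ht.2))
end
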